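/- Let h be a Legendre function on ℝ^d, let x ∈ int dom h, and let (x_k)_{k∈ℕ} be a sequence in int dom h such that D_h(x, x_k) ≤ c for some constant c > 0 and all k ∈ ℕ. Then the closure of the set {x_k : k ∈ ℕ} is contained in int dom h. -/

import Mathlib

open scoped RealInnerProductSpace
open Filter Topology Set

noncomputable section

/-- A Legendre function on ℝ^d: proper (nonempty effective domain, real-valued there),
closed (closed epigraph), convex, with nonempty interior of its domain, differentiable and
strictly convex on the interior of its domain, and with gradients blowing up along sequences
converging to boundary points of the domain. -/
structure LegendreFn (d : ℕ) where
  dom : Set (EuclideanSpace ℝ (Fin d))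
  f : EuclideanSpace ℝ (Fin d) → ℝ
  grad : EuclideanSpace ℝ (Fin d) → EuclideanSpace ℝ (Fin d)
  dom_nonempty : dom.Nonempty
  dom_convex : Convex ℝ dom
  interior_nonempty : (interior dom).Nonempty
  convexOn : ConvexOn ℝ dom f
  closed_epigraph : IsClosed {p : EuclideanSpace ℝ (Fin d) × ℝ | p.1 ∈ dom ∧ f p.1 ≤ p.2}
  diff : ∀ x ∈ interior dom, HasGradientAt f (grad x) x
  strictConvexOn : StrictConvexOn ℝ (interior dom) f
  grad_blowup : ∀ (y : ℕ → EuclideanSpace ℝ (Fin d)) (z : EuclideanSpace ℝ (Fin d)),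
      (∀ j, y j ∈ interior dom) → z ∈ frontier dom →
      Tendsto y atTop (nhds z) →
      Tendsto (fun j => ‖grad (y j)‖) atTop atTop

/-- The Bregman divergence D_h(x, y) = h(x) − h(y) − ⟨∇h(y), x − y⟩. -/
def bregman {d : ℕ} (h : LegendreFn d) (x y : EuclideanSpace ℝ (Fin d)) : ℝ :=
  h.f x - h.f y - ⟪h.grad y, x - y⟫

/-- A proper closed convex function on ℝ^d, modeled as a real-valued function on its
(nonempty) effective domain, equal to +∞ outside; closedness is encoded by the epigraph
being closed. -/
structure ProperConvexFn (d : ℕ) where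
  dom : Set (EuclideanSpace ℝ (Fin d))
  f : EuclideanSpace ℝ (Fin d) → ℝ
  dom_nonempty : dom.Nonempty
  convexOn : ConvexOn ℝ dom f
  closed_epigraph : IsClosed {p : EuclideanSpace ℝ (Fin d) × ℝ | p.1 ∈ dom ∧ f p.1 ≤ p.2}

/-- g is a subgradient of f at x: f(y) ≥ f(x) + ⟨g, y − x⟩ for all y (the inequality is
trivial outside the effective domain, where f is +∞). -/
def IsSubgradientAt {d : ℕ} (F : ProperConvexFn d) (g x : EuclideanSpace ℝ (Fin d)) : Prop :=
  ∀ y ∈ F.dom, F.f x + ⟪g, y - x⟫ ≤ F.f y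

/-- A (not necessarily Euclidean) norm on ℝ^d. -/
structure NormFn (d : ℕ) where
  N : EuclideanSpace ℝ (Fin d) → ℝ
  eq_zero_iff : ∀ x, N x = 0 ↔ x = 0
  smul : ∀ (a : ℝ) (x : EuclideanSpace ℝ (Fin d)), N (a • x) = |a| * N x
  triangle : ∀ x y, N (x + y) ≤ N x + N y

/-- The dual norm ‖g‖_* = sup{⟨g, u⟩ : ‖u‖ ≤ 1}. -/
def NormFn.dual {d : ℕ} (P : NormFn d) (g : EuclideanSpace ℝ (Fin d)) : ℝ :=
  sSup {r : ℝ | ∃ u, P.N u ≤ 1 ∧ r = ⟪g, u⟫}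

/-- x₊ = T(x; η): a minimizer over y ∈ X of ⟨g, y − x⟩ + D_h(y, x)/η
(the objective being +∞ outside dom h). -/
def IsMirrorStep {d : ℕ} (h : LegendreFn d) (X : Set (EuclideanSpace ℝ (Fin d)))
    (g x : EuclideanSpace ℝ (Fin d)) (η : ℝ) (xp : EuclideanSpace ℝ (Fin d)) : Prop :=
  xp ∈ X ∩ h.dom ∧ ∀ y ∈ X ∩ h.dom,
    ⟪g, xp - x⟫ + bregman h xp x / η ≤ ⟪g, y - x⟫ + bregman h y x / η

/-- The gradient inequality for a convex function. -/
theorem ConvexOn.add_inner_gradient_le {E : Type*} [NormedAddCommGroup E]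
    [InnerProductSpace ℝ E] [CompleteSpace E] {s : Set E} {f : E → ℝ} {g y z : E}
    (hf : ConvexOn ℝ s f) (hy : y ∈ s) (hz : z ∈ s) (hg : HasGradientAt f g y) :
    f y + ⟪g, z - y⟫ ≤ f z := by
  have hφ : ConvexOn ℝ (AffineMap.lineMap y z ⁻¹' s) (f ∘ AffineMap.lineMap (k := ℝ) y z) :=
    hf.comp_affineMap _
  have hd : HasDerivAt (f ∘ AffineMap.lineMap (k := ℝ) y z) ⟪g, z - y⟫ 0 := by
    have h₁ : HasFDerivAt f (InnerProductSpace.toDual ℝ E g)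
        (AffineMap.lineMap y z (0 : ℝ)) := by
      simpa using hg.hasFDerivAt
    simpa using h₁.comp_hasDerivAt (0 : ℝ) AffineMap.hasDerivAt_lineMap
  have h₂ := hφ.le_slope_of_hasDerivAt (x := 0) (y := 1) (by simpa using hy) (by simpa using hz)
    one_pos hd
  simp [slope_def_field] at h₂
  linarith

/-- The gradients at points from which an interior point has bounded Bregman divergence
are uniformly bounded. -/
theorem LegendreFn.exists_norm_grad_le {d : ℕ} (h : LegendreFn d)
    {x : EuclideanSpace ℝ (Fin d)} (hx : x ∈ interior h.dom) (c : ℝ) :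
    ∃ B, ∀ y ∈ interior h.dom, bregman h x y ≤ c → ‖h.grad y‖ ≤ B := by
  have hev : ∀ᶠ w in 𝓝 x, w ∈ h.dom ∧ h.f w < h.f x + 1 :=
    (eventually_mem_set.2 (mem_interior_iff_mem_nhds.1 hx)).and
      ((h.diff x hx).differentiableAt.continuousAt.eventually_lt_const (by linarith))
  obtain ⟨r, hr, hball⟩ := Metric.nhds_basis_closedBall.eventually_iff.1 hev
  refine ⟨(1 + c) / r, fun y hy hyc => ?_⟩
  rw [le_div_iff₀ hr]
  set g := h.grad y with hg
  obtain ⟨u, hu, hgu⟩ : ∃ u : EuclideanSpace ℝ (Fin d), ‖u‖ ≤ r ∧ ⟪g, u⟫ = ‖g‖ * r := by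
    refine ⟨(r * ‖g‖⁻¹) • g, ?_, ?_⟩
    · rw [norm_smul, norm_mul, norm_inv, norm_norm, Real.norm_of_nonneg hr.le, mul_assoc]
      exact mul_le_of_le_one_right hr.le inv_mul_le_one
    · rw [inner_smul_right, real_inner_self_eq_norm_sq]
      rcases eq_or_ne ‖g‖ 0 with h₀ | h₀
      · simp [h₀]
      · field_simp
  obtain ⟨hmem, hlt⟩ := hball (show x + u ∈ Metric.closedBall x r by simpa using hu)
  have hineq := h.convexOn.add_inner_gradient_le (interior_subset hy) hmem (h.diff y hy)
  rw [← hg, add_sub_right_comm, inner_add_right, hgu] at hineq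
  rw [bregman, ← hg] at hyc
  linarith

/-- If `h` is Legendre, `x ∈ int dom h`, and `D_h(x, x_k) ≤ c` for a sequence `(x_k)` in
`int dom h`, then the closure of `{x_k : k ∈ ℕ}` is contained in `int dom h`. -/
theorem closure_subset_interior_of_bregman_bounded {d : ℕ} (h : LegendreFn d)
    (x : EuclideanSpace ℝ (Fin d)) (hx : x ∈ interior h.dom)
    (xk : ℕ → EuclideanSpace ℝ (Fin d)) (hxk : ∀ k, xk k ∈ interior h.dom)
    (c : ℝ) (hc : 0 < c) (hbd : ∀ k, bregman h x (xk k) ≤ c) :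
    closure (Set.range xk) ⊆ interior h.dom := by
  intro z hz
  obtain ⟨y, hy, hyz⟩ := mem_closure_iff_seq_limit.1 hz
  have hyprop : ∀ j, y j ∈ interior h.dom ∧ bregman h x (y j) ≤ c := fun j => by
    obtain ⟨k, hk⟩ := hy j
    exact hk ▸ ⟨hxk k, hbd k⟩
  obtain ⟨B, hB⟩ := h.exists_norm_grad_le hx c
  by_contra hzint
  have hzcl : z ∈ closure h.dom :=
    mem_closure_of_tendsto hyz (.of_forall fun j => interior_subset (hyprop j).1)
  have hblow := h.grad_blowup y z (fun j => (hyprop j).1) ⟨hzcl, hzint⟩ hyz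
  obtain ⟨j, hj⟩ := (hblow.eventually_gt_atTop B).exists
  exact hj.not_ge (hB _ (hyprop j).1 (hyprop j).2)
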